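/- Let G be a graph on m vertices and K a κ-subset of the vertices such that the number of edges of G with both endpoints in K is at least (1/2+ε)·κ(κ−1)/2, where ε ∈ (0,1/2] and κ ≥ (1+2ε)/ε. Let u_1,…,u_n, w_1,…,w_p be drawn uniformly at random without replacement from the vertex set (all n+p vertices distinct), with m > 2n and m > 2p, and set U = {u_1,…,u_n}, W = {w_1,…,w_p}. Define N_{U,W;K} = Σ_{u∈K} Σ_{w∈K} 1{u∈U}·1{w∈W}·1{u∼w}. Then P( N_{U,W;K} < (1/2+ε/4)·npκ²/m² ) ≤ (4/ε)·√( m(pκ+nκ+m)/(npκ²) ). -/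

import Mathlib

open Finset
open scoped Classical

/-- All pairs `(U, W)` of disjoint subsets of the vertex set with `#U = n`, `#W = p`:
the possible outcomes of drawing `n + p` distinct vertices without replacement. -/
noncomputable def pairSets (m n p : ℕ) : Finset (Finset (Fin m) × Finset (Fin m)) :=
  Finset.univ.filter fun UW => UW.1.card = n ∧ UW.2.card = p ∧ Disjoint UW.1 UW.2

/-- `N_{U,W;K} = Σ_{u∈K} Σ_{w∈K} 1{u∈U}·1{w∈W}·1{u∼w}`. -/
noncomputable def NUWK (m : ℕ) (G : SimpleGraph (Fin m)) (K U W : Finset (Fin m)) : ℝ :=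
  ∑ u ∈ K, ∑ w ∈ K, if u ∈ U ∧ w ∈ W ∧ G.Adj u w then 1 else 0

/-- The number of outcomes `(U, W)` with `A ⊆ U` and `B ⊆ W`. -/
noncomputable def supersetCount (m n p : ℕ) (A B : Finset (Fin m)) : ℕ :=
  ((pairSets m n p).filter fun UW => A ⊆ UW.1 ∧ B ⊆ UW.2).card

lemma mem_pairSets {m n p : ℕ} {UW : Finset (Fin m) × Finset (Fin m)} :
    UW ∈ pairSets m n p ↔ UW.1.card = n ∧ UW.2.card = p ∧ Disjoint UW.1 UW.2 := by
  simp [pairSets]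

lemma supersetCount_empty (m n p : ℕ) :
    supersetCount m n p ∅ ∅ = (pairSets m n p).card := by
  simp [supersetCount]

lemma supersetCount_comm (m n p : ℕ) (A B : Finset (Fin m)) :
    supersetCount m n p A B = supersetCount m p n B A := by
  unfold supersetCount
  refine Finset.card_nbij' Prod.swap Prod.swap ?_ ?_ ?_ ?_
  · intro UW h
    simp only [Finset.coe_filter, Set.mem_ofPred_eq, mem_pairSets] at h ⊢
    exact ⟨⟨h.1.2.1, h.1.1, h.1.2.2.symm⟩, h.2.2, h.2.1⟩
  · intro UW h
    simp only [Finset.coe_filter, Set.mem_ofPred_eq, mem_pairSets] at h ⊢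
    exact ⟨⟨h.1.2.1, h.1.1, h.1.2.2.symm⟩, h.2.2, h.2.1⟩
  · intro UW _; rfl
  · intro UW _; rfl

lemma supersetCount_map_le (m n p : ℕ) (A B : Finset (Fin m)) (σ : Equiv.Perm (Fin m)) :
    supersetCount m n p A B ≤
      supersetCount m n p (A.map σ.toEmbedding) (B.map σ.toEmbedding) := by
  unfold supersetCount
  refine Finset.card_le_card_of_injOn
    (fun UW => (UW.1.map σ.toEmbedding, UW.2.map σ.toEmbedding)) ?_ ?_
  · intro UW h
    simp only [Finset.coe_filter, Set.mem_ofPred_eq, mem_pairSets, Finset.card_map,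
      Finset.disjoint_map, Finset.map_subset_map] at h ⊢
    exact h
  · rintro ⟨U, W⟩ _ ⟨U', W'⟩ _ h
    simpa using h

lemma map_swap_eq_self {α : Type*} [DecidableEq α] {x y : α} {A : Finset α}
    (hx : x ∉ A) (hy : y ∉ A) : A.map (Equiv.swap x y).toEmbedding = A := by
  ext a
  rw [Finset.mem_map_equiv, Equiv.symm_swap]
  by_cases hax : a = x
  · subst hax; simp [hx, hy]
  by_cases hay : a = y
  · subst hay; simp [hx, hy]
  rw [Equiv.swap_apply_of_ne_of_ne hax hay]

lemma supersetCount_insert_le (m n p : ℕ) {A B : Finset (Fin m)} {x y : Fin m}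
    (hxA : x ∉ A) (hxB : x ∉ B) (hyA : y ∉ A) (hyB : y ∉ B) :
    supersetCount m n p (insert x A) B ≤ supersetCount m n p (insert y A) B := by
  have h := supersetCount_map_le m n p (insert x A) B (Equiv.swap x y)
  rw [Finset.map_insert, map_swap_eq_self hxA hyA, map_swap_eq_self hxB hyB] at h
  simpa using h

/-- Double counting of the pairs `(y, (U, W))` with `A ⊆ U`, `B ⊆ W` and `y ∈ U \ A`. -/
lemma supersetCount_insert_left (m n p : ℕ) {A B : Finset (Fin m)} {x : Fin m}
    (hAB : Disjoint A B) (hxA : x ∉ A) (hxB : x ∉ B) :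
    (m - (A.card + B.card)) * supersetCount m n p (insert x A) B =
      (n - A.card) * supersetCount m n p A B := by
  have hcompl : ((A ∪ B)ᶜ : Finset (Fin m)).card = m - (A.card + B.card) := by
    rw [Finset.card_compl, Finset.card_union_of_disjoint hAB, Fintype.card_fin]
  have key := Finset.sum_card_bipartiteAbove_eq_sum_card_bipartiteBelow
    (s := (A ∪ B)ᶜ)
    (t := (pairSets m n p).filter fun UW => A ⊆ UW.1 ∧ B ⊆ UW.2)
    (fun (y : Fin m) (UW : Finset (Fin m) × Finset (Fin m)) => y ∈ UW.1)
  have hl : ∀ y ∈ (A ∪ B)ᶜ, (Finset.bipartiteAbove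
      (fun (y : Fin m) (UW : Finset (Fin m) × Finset (Fin m)) => y ∈ UW.1)
      ((pairSets m n p).filter fun UW => A ⊆ UW.1 ∧ B ⊆ UW.2) y).card =
      supersetCount m n p (insert x A) B := by
    intro y hy
    simp only [Finset.mem_compl, Finset.mem_union, not_or] at hy
    rw [le_antisymm (supersetCount_insert_le m n p hxA hxB hy.1 hy.2)
      (supersetCount_insert_le m n p hy.1 hy.2 hxA hxB), Finset.bipartiteAbove,
      Finset.filter_filter, supersetCount]
    congr 1
    ext UW
    simp only [Finset.mem_filter, Finset.insert_subset_iff]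
    tauto
  have hr : ∀ UW ∈ ((pairSets m n p).filter fun UW => A ⊆ UW.1 ∧ B ⊆ UW.2),
      (Finset.bipartiteBelow
      (fun (y : Fin m) (UW : Finset (Fin m) × Finset (Fin m)) => y ∈ UW.1)
      (A ∪ B)ᶜ UW).card = n - A.card := by
    intro UW h
    simp only [Finset.mem_filter, mem_pairSets] at h
    obtain ⟨⟨hU, -, hd⟩, hA, hB⟩ := h
    rw [← hU, ← Finset.card_sdiff_of_subset hA, Finset.bipartiteBelow]
    congr 1
    ext y
    simp only [Finset.mem_filter, Finset.mem_compl, Finset.mem_union, Finset.mem_sdiff, not_or]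
    exact ⟨fun h => ⟨h.2, h.1.1⟩,
      fun h => ⟨⟨h.2, fun hb => Finset.disjoint_left.1 hd h.1 (hB hb)⟩, h.1⟩⟩
  rw [Finset.sum_congr rfl hl, Finset.sum_congr rfl hr, Finset.sum_const, Finset.sum_const,
    hcompl, smul_eq_mul, smul_eq_mul] at key
  rw [key, mul_comm]
  rfl

lemma supersetCount_insert_right (m n p : ℕ) {A B : Finset (Fin m)} {x : Fin m}
    (hAB : Disjoint A B) (hxA : x ∉ A) (hxB : x ∉ B) :
    (m - (A.card + B.card)) * supersetCount m n p A (insert x B) =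
      (p - B.card) * supersetCount m n p A B := by
  rw [supersetCount_comm m n p A, supersetCount_comm m n p A, add_comm]
  exact supersetCount_insert_left m p n hAB.symm hxB hxA

lemma supersetCount_eq_zero (m n p : ℕ) {A B : Finset (Fin m)} (h : ¬ Disjoint A B) :
    supersetCount m n p A B = 0 := by
  rw [supersetCount, Finset.card_eq_zero, Finset.filter_eq_empty_iff]
  intro UW hUW hAB
  exact h ((mem_pairSets.1 hUW).2.2.mono hAB.1 hAB.2)

section Probabilities

variable {m n p : ℕ}

lemma supersetCount_one_one (hm : 4 ≤ m) {u w : Fin m} (huw : u ≠ w) :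
    (supersetCount m n p {u} {w} : ℝ) =
      (pairSets m n p).card * ((n * p : ℝ) / (m * (m - 1))) := by
  have h1 := supersetCount_insert_left m n p (A := ∅) (B := ∅) (x := u)
    (by simp) (by simp) (by simp)
  have h2 := supersetCount_insert_right m n p (A := {u}) (B := ∅) (x := w)
    (by simp) (by simpa using huw.symm) (by simp)
  simp only [Finset.card_empty, Finset.card_singleton, insert_empty_eq, supersetCount_empty,
    Nat.add_zero, Nat.sub_zero] at h1 h2
  have hm' : (4 : ℝ) ≤ m := by exact_mod_cast hm
  have h1' : (m : ℝ) * supersetCount m n p {u} ∅ = n * (pairSets m n p).card := by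
    exact_mod_cast h1
  have h2' : ((m : ℝ) - 1) * supersetCount m n p {u} {w} =
      p * supersetCount m n p {u} ∅ := by
    have := congrArg (Nat.cast : ℕ → ℝ) h2
    push_cast [Nat.cast_sub (show 1 ≤ m by omega)] at this
    exact this
  have : (m : ℝ) - 1 ≠ 0 := by linarith
  have : (m : ℝ) ≠ 0 := by linarith
  field_simp
  linear_combination (m : ℝ) * h2' + (p : ℝ) * h1'

lemma supersetCount_one_two (hm : 4 ≤ m) (hp1 : 1 ≤ p) {u w w' : Fin m} (huw : u ≠ w)
    (huw' : u ≠ w') (hww : w ≠ w') :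
    (supersetCount m n p {u} {w, w'} : ℝ) =
      (pairSets m n p).card * ((n * p : ℝ) / (m * (m - 1)) * ((p - 1) / (m - 2))) := by
  have h := supersetCount_insert_right m n p (A := {u}) (B := {w'}) (x := w)
    (by simpa using huw') (by simpa using huw.symm) (by simpa using hww)
  have hm' : (4 : ℝ) ≤ m := by exact_mod_cast hm
  have hcast := congrArg (Nat.cast : ℕ → ℝ) h
  simp only [Finset.card_singleton] at hcast
  push_cast [Nat.cast_sub (show 1 + 1 ≤ m by omega), Nat.cast_sub hp1] at hcast
  rw [supersetCount_one_one hm huw'] at hcast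
  have : (m : ℝ) - 2 ≠ 0 := by linarith
  rw [← mul_assoc, ← mul_div_assoc, eq_div_iff this]
  linear_combination hcast

lemma supersetCount_two_one (hm : 4 ≤ m) (hn1 : 1 ≤ n) {u u' w : Fin m} (huw : u ≠ w)
    (huw' : u' ≠ w) (huu : u ≠ u') :
    (supersetCount m n p {u, u'} {w} : ℝ) =
      (pairSets m n p).card * ((n * p : ℝ) / (m * (m - 1)) * ((n - 1) / (m - 2))) := by
  have h := supersetCount_insert_left m n p (A := {u'}) (B := {w}) (x := u)
    (by simpa using huw') (by simpa using huu) (by simpa using huw)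
  have hm' : (4 : ℝ) ≤ m := by exact_mod_cast hm
  have hcast := congrArg (Nat.cast : ℕ → ℝ) h
  simp only [Finset.card_singleton] at hcast
  push_cast [Nat.cast_sub (show 1 + 1 ≤ m by omega), Nat.cast_sub hn1] at hcast
  rw [supersetCount_one_one hm huw'] at hcast
  have : (m : ℝ) - 2 ≠ 0 := by linarith
  rw [← mul_assoc, ← mul_div_assoc, eq_div_iff this]
  linear_combination hcast

lemma supersetCount_two_two (hm : 4 ≤ m) (hn1 : 1 ≤ n) (hp1 : 1 ≤ p) {u u' w w' : Fin m}
    (huw : u ≠ w) (huw' : u ≠ w') (hu'w : u' ≠ w) (hu'w' : u' ≠ w') (huu : u ≠ u')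
    (hww : w ≠ w') :
    (supersetCount m n p {u, u'} {w, w'} : ℝ) =
      (pairSets m n p).card * ((n * p : ℝ) / (m * (m - 1)) *
        (((n - 1) * (p - 1)) / ((m - 2) * (m - 3)))) := by
  have h := supersetCount_insert_left m n p (A := {u'}) (B := {w, w'}) (x := u)
    (by simp [hu'w, hu'w']) (by simpa using huu) (by simp [huw, huw'])
  have hm' : (4 : ℝ) ≤ m := by exact_mod_cast hm
  have hcast := congrArg (Nat.cast : ℕ → ℝ) h
  simp only [Finset.card_singleton, Finset.card_pair hww] at hcast
  push_cast [Nat.cast_sub (show 1 + 2 ≤ m by omega), Nat.cast_sub hn1] at hcast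
  rw [supersetCount_one_two hm hp1 hu'w hu'w' hww] at hcast
  have h2 : (m : ℝ) - 2 ≠ 0 := by linarith
  have h3 : (m : ℝ) - 3 ≠ 0 := by linarith
  have h23 : ((m : ℝ) - 2) * (m - 3) ≠ 0 := mul_ne_zero h2 h3
  rw [← mul_assoc, ← mul_div_assoc, eq_div_iff h23]
  field_simp at hcast ⊢
  linear_combination hcast

/-- Negative correlation, up to the terms coming from coinciding endpoints. -/
lemma supersetCount_pair_le (hm : 4 ≤ m) (hn1 : 1 ≤ n) (hp1 : 1 ≤ p)
    (hn : 2 * n < m) (hp : 2 * p < m) {e f : Fin m × Fin m}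
    (he : e.1 ≠ e.2) (hf : f.1 ≠ f.2) :
    (supersetCount m n p {e.1, f.1} {e.2, f.2} : ℝ) ≤
      (pairSets m n p).card * (((n * p : ℝ) / (m * (m - 1))) ^ 2 +
        (n * p : ℝ) / (m * (m - 1)) * ((if e = f then 1 else 0) +
          (if e.1 = f.1 then (p : ℝ) / m else 0) + (if e.2 = f.2 then (n : ℝ) / m else 0))) := by
  obtain ⟨u, w⟩ := e
  obtain ⟨u', w'⟩ := f
  simp only [ne_eq, Prod.mk.injEq] at he hf ⊢
  have hm' : (4 : ℝ) ≤ m := by exact_mod_cast hm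
  have hn' : (2 : ℝ) * n + 1 ≤ m := by exact_mod_cast hn
  have hp' : (2 : ℝ) * p + 1 ≤ m := by exact_mod_cast hp
  have hn1' : (1 : ℝ) ≤ n := by exact_mod_cast hn1
  have hp1' : (1 : ℝ) ≤ p := by exact_mod_cast hp1
  have hm1 : (0 : ℝ) < m - 1 := by linarith
  have hm2 : (0 : ℝ) < m - 2 := by linarith
  have hm3 : (0 : ℝ) < m - 3 := by linarith
  have hm0 : (0 : ℝ) < m := by linarith
  set q : ℝ := (n * p : ℝ) / (m * (m - 1)) with hq
  have hq0 : 0 ≤ q := by positivity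
  have hpm : 0 ≤ (p : ℝ) / m := by positivity
  have hnm : 0 ≤ (n : ℝ) / m := by positivity
  by_cases huu : u = u'
  · subst huu
    by_cases hww : w = w'
    · subst hww
      simp only [Finset.insert_eq_of_mem, Finset.mem_singleton]
      rw [supersetCount_one_one hm he, ← hq]
      gcongr
      simp only [and_self, if_true]
      nlinarith [mul_nonneg hq0 hpm, mul_nonneg hq0 hnm]
    · simp only [Finset.insert_eq_of_mem, Finset.mem_singleton]
      rw [supersetCount_one_two hm hp1 he hf hww, ← hq]
      gcongr
      simp only [hww, and_false, if_true, if_false, zero_add, add_zero]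
      have : ((p : ℝ) - 1) / (m - 2) ≤ p / m := by
        rw [div_le_div_iff₀ hm2 hm0]; nlinarith
      nlinarith [mul_le_mul_of_nonneg_left this hq0]
  · by_cases hww : w = w'
    · subst hww
      simp only [Finset.insert_eq_of_mem, Finset.mem_singleton]
      rw [supersetCount_two_one hm hn1 he hf huu, ← hq]
      gcongr
      simp only [huu, false_and, if_true, if_false, zero_add]
      have : ((n : ℝ) - 1) / (m - 2) ≤ n / m := by
        rw [div_le_div_iff₀ hm2 hm0]; nlinarith
      nlinarith [mul_le_mul_of_nonneg_left this hq0]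
    · simp only [huu, hww, false_and, if_false, add_zero, mul_zero]
      by_cases h1 : u = w'
      · rw [supersetCount_eq_zero]
        · push_cast; positivity
        · simp [h1]
      by_cases h2 : u' = w
      · rw [supersetCount_eq_zero]
        · push_cast; positivity
        · simp [h2]
      rw [supersetCount_two_two hm hn1 hp1 he h1 h2 hf huu hww, ← hq, sq]
      gcongr
      rw [hq, div_le_div_iff₀ (by positivity) (by positivity)]
      have hA : ((n : ℝ) - 1) * (m - 1) ≤ n * (m - 3) := by nlinarith
      have hB : ((p : ℝ) - 1) * (m - 1) ≤ p * (m - 3) := by nlinarith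
      have hAB : (((n : ℝ) - 1) * (m - 1)) * ((p - 1) * (m - 1)) ≤
          (n * (m - 3)) * (p * (m - 3)) :=
        mul_le_mul hA hB (by apply mul_nonneg <;> linarith) (by positivity)
      have hC : (m : ℝ) * (m - 3) ≤ (m - 1) * (m - 2) := by nlinarith
      have hnp : 0 ≤ (n : ℝ) * p * (m - 3) := by positivity
      refine le_of_mul_le_mul_right ?_ hm1
      calc ((n : ℝ) - 1) * (p - 1) * (m * (m - 1)) * (m - 1)
          = m * ((((n : ℝ) - 1) * (m - 1)) * ((p - 1) * (m - 1))) := by ring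
        _ ≤ m * ((n * (m - 3)) * (p * (m - 3))) := by gcongr
        _ = (n * p * (m - 3)) * (m * (m - 3)) := by ring
        _ ≤ (n * p * (m - 3)) * ((m - 1) * (m - 2)) := by gcongr
        _ = n * p * ((m - 2) * (m - 3)) * (m - 1) := by ring

end Probabilities

/-- The ordered pairs of adjacent vertices of `K`. -/
noncomputable def adjPairs {m : ℕ} (G : SimpleGraph (Fin m)) (K : Finset (Fin m)) :
    Finset (Fin m × Fin m) :=
  (K ×ˢ K).filter fun e => G.Adj e.1 e.2

lemma mem_adjPairs {m : ℕ} {G : SimpleGraph (Fin m)} {K : Finset (Fin m)}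
    {e : Fin m × Fin m} :
    e ∈ adjPairs G K ↔ (e.1 ∈ K ∧ e.2 ∈ K) ∧ G.Adj e.1 e.2 := by
  simp [adjPairs]

lemma two_mul_card_edges_le {m : ℕ} (G : SimpleGraph (Fin m)) (K : Finset (Fin m)) :
    2 * (G.edgeFinset.filter fun e => ∀ v ∈ e, v ∈ K).card ≤ (adjPairs G K).card := by
  have hmaps : ∀ e ∈ adjPairs G K,
      s(e.1, e.2) ∈ G.edgeFinset.filter fun e => ∀ v ∈ e, v ∈ K := by
    intro e he
    rw [mem_adjPairs] at he
    simp only [Finset.mem_filter, SimpleGraph.mem_edgeFinset, SimpleGraph.mem_edgeSet,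
      Sym2.mem_iff]
    refine ⟨he.2, ?_⟩
    rintro v (rfl | rfl)
    exacts [he.1.1, he.1.2]
  rw [Finset.card_eq_sum_card_fiberwise hmaps, mul_comm, ← smul_eq_mul]
  refine Finset.card_nsmul_le_sum _ _ _ ?_
  intro e he
  induction e using Sym2.ind with
  | _ a b =>
    simp only [Finset.mem_filter, SimpleGraph.mem_edgeFinset, SimpleGraph.mem_edgeSet,
      Sym2.mem_iff] at he
    have ha := he.2 a (Or.inl rfl)
    have hb := he.2 b (Or.inr rfl)
    have hne : (a, b) ≠ (b, a) := fun h => he.1.ne (congrArg Prod.fst h)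
    rw [← Finset.card_pair hne]
    refine Finset.card_le_card ?_
    intro x hx
    simp only [Finset.mem_insert, Finset.mem_singleton] at hx
    rcases hx with rfl | rfl
    · simp [mem_adjPairs, ha, hb, he.1]
    · simp [mem_adjPairs, ha, hb, he.1.symm]

lemma card_adjPairs_le {m : ℕ} (G : SimpleGraph (Fin m)) (K : Finset (Fin m)) :
    ((adjPairs G K).card : ℝ) ≤ K.card * (K.card - 1) := by
  have h : (adjPairs G K).card ≤ K.offDiag.card := by
    refine Finset.card_le_card fun e he => ?_
    rw [mem_adjPairs] at he
    exact Finset.mem_offDiag.2 ⟨he.1.1, he.1.2, he.2.ne⟩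
  rw [Finset.offDiag_card] at h
  have hcast : ((adjPairs G K).card : ℝ) ≤ ((K.card * K.card - K.card : ℕ) : ℝ) := by
    exact_mod_cast h
  rw [Nat.cast_sub (Nat.le_mul_self _)] at hcast
  push_cast at hcast
  linarith

lemma card_filter_fst_le {m : ℕ} (G : SimpleGraph (Fin m)) (K : Finset (Fin m)) (u : Fin m) :
    ((adjPairs G K).filter fun f => u = f.1).card ≤ K.card := by
  refine Finset.card_le_card_of_injOn Prod.snd ?_ ?_
  · intro f hf
    exact (mem_adjPairs.1 (Finset.mem_filter.1 hf).1).1.2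
  · intro f hf g hg h
    exact Prod.ext ((Finset.mem_filter.1 hf).2.symm.trans (Finset.mem_filter.1 hg).2) h

lemma card_filter_snd_le {m : ℕ} (G : SimpleGraph (Fin m)) (K : Finset (Fin m)) (w : Fin m) :
    ((adjPairs G K).filter fun f => w = f.2).card ≤ K.card := by
  refine Finset.card_le_card_of_injOn Prod.fst ?_ ?_
  · intro f hf
    exact (mem_adjPairs.1 (Finset.mem_filter.1 hf).1).1.1
  · intro f hf g hg h
    exact Prod.ext h ((Finset.mem_filter.1 hf).2.symm.trans (Finset.mem_filter.1 hg).2)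

lemma NUWK_eq_sum_adjPairs {m : ℕ} (G : SimpleGraph (Fin m)) (K U W : Finset (Fin m)) :
    NUWK m G K U W = ∑ e ∈ adjPairs G K, if e.1 ∈ U ∧ e.2 ∈ W then (1 : ℝ) else 0 := by
  rw [NUWK, adjPairs, Finset.sum_filter, Finset.sum_product]
  refine Finset.sum_congr rfl fun u _ => Finset.sum_congr rfl fun w _ => ?_
  by_cases h : G.Adj u w <;> simp [h]

lemma sum_NUWK (m n p : ℕ) (G : SimpleGraph (Fin m)) (K : Finset (Fin m)) :
    ∑ UW ∈ pairSets m n p, NUWK m G K UW.1 UW.2 =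
      ∑ e ∈ adjPairs G K, (supersetCount m n p {e.1} {e.2} : ℝ) := by
  simp only [NUWK_eq_sum_adjPairs]
  rw [Finset.sum_comm]
  refine Finset.sum_congr rfl fun e _ => ?_
  rw [Finset.sum_boole, supersetCount]
  simp only [Finset.singleton_subset_iff]

lemma sum_NUWK_sq (m n p : ℕ) (G : SimpleGraph (Fin m)) (K : Finset (Fin m)) :
    ∑ UW ∈ pairSets m n p, NUWK m G K UW.1 UW.2 ^ 2 =
      ∑ e ∈ adjPairs G K, ∑ f ∈ adjPairs G K,
        (supersetCount m n p {e.1, f.1} {e.2, f.2} : ℝ) := by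
  simp only [NUWK_eq_sum_adjPairs, sq, Finset.sum_mul_sum]
  rw [Finset.sum_comm]
  refine Finset.sum_congr rfl fun e _ => ?_
  rw [Finset.sum_comm]
  refine Finset.sum_congr rfl fun f _ => ?_
  simp only [← ite_and, ite_mul, one_mul, zero_mul]
  rw [Finset.sum_boole, supersetCount]
  simp only [Finset.insert_subset_iff, Finset.singleton_subset_iff]
  congr 2
  ext UW
  simp only [Finset.mem_filter]
  tauto

/-- The variance bound, multiplied by the number of outcomes. -/
lemma sum_NUWK_sub_mean_sq_le {m n p : ℕ} (G : SimpleGraph (Fin m)) (K : Finset (Fin m))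
    (hm : 4 ≤ m) (hn1 : 1 ≤ n) (hp1 : 1 ≤ p) (hn : 2 * n < m) (hp : 2 * p < m) :
    ∑ UW ∈ pairSets m n p, (NUWK m G K UW.1 UW.2 -
        (adjPairs G K).card * ((n * p : ℝ) / (m * (m - 1)))) ^ 2 ≤
      (pairSets m n p).card * ((n * p * K.card ^ 2 / m ^ 2 : ℝ) *
        (p * K.card / m + n * K.card / m + 1)) := by
  have hm' : (4 : ℝ) ≤ m := by exact_mod_cast hm
  have hm1 : (0 : ℝ) < m - 1 := by linarith
  have hm0 : (0 : ℝ) < m := by linarith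
  have hKm : (K.card : ℝ) ≤ m := by
    exact_mod_cast (Finset.card_le_univ K).trans_eq (Fintype.card_fin m)
  have hD := card_adjPairs_le G K
  have hfirst := sum_NUWK m n p G K
  have hsecond := sum_NUWK_sq m n p G K
  rw [Finset.sum_congr rfl fun e he =>
    supersetCount_one_one hm (mem_adjPairs.1 he).2.ne, Finset.sum_const, nsmul_eq_mul] at hfirst
  set q : ℝ := (n * p : ℝ) / (m * (m - 1)) with hq
  set D : ℝ := ((adjPairs G K).card : ℝ) with hDdef
  set T : ℝ := ((pairSets m n p).card : ℝ) with hT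
  set k : ℝ := (K.card : ℝ) with hk
  have hq0 : 0 ≤ q := by positivity
  have hT0 : 0 ≤ T := by positivity
  have hD0 : 0 ≤ D := by positivity
  have hk0 : 0 ≤ k := by positivity
  have hsq : ∑ UW ∈ pairSets m n p, NUWK m G K UW.1 UW.2 ^ 2 ≤
      D * (T * (D * q ^ 2 + q * (1 + k * (p / m) + k * (n / m)))) := by
    rw [hsecond, hDdef, ← nsmul_eq_mul]
    refine Finset.sum_le_card_nsmul _ _ _ fun e he => ?_
    refine (Finset.sum_le_sum fun f hf => supersetCount_pair_le hm hn1 hp1 hn hp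
      (mem_adjPairs.1 he).2.ne (mem_adjPairs.1 hf).2.ne).trans ?_
    rw [← Finset.mul_sum, Finset.sum_add_distrib, ← Finset.mul_sum, Finset.sum_add_distrib,
      Finset.sum_add_distrib, Finset.sum_const, nsmul_eq_mul, Finset.sum_ite_eq, if_pos he,
      ← Finset.sum_filter, ← Finset.sum_filter, Finset.sum_const, Finset.sum_const,
      nsmul_eq_mul, nsmul_eq_mul]
    have h1 : (((adjPairs G K).filter fun f => e.1 = f.1).card : ℝ) ≤ k := by
      exact Nat.cast_le.2 (card_filter_fst_le G K e.1)
    have h2 : (((adjPairs G K).filter fun f => e.2 = f.2).card : ℝ) ≤ k := by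
      exact Nat.cast_le.2 (card_filter_snd_le G K e.2)
    gcongr
  have hDq : D * q ≤ n * p * k ^ 2 / m ^ 2 := by
    have h1 : (k - 1) / (m - 1) ≤ k / m := by
      rw [div_le_div_iff₀ hm1 hm0]; linarith
    calc D * q ≤ (k * (k - 1)) * q := by gcongr
      _ = n * p * k / m * ((k - 1) / (m - 1)) := by rw [hq]; field_simp
      _ ≤ n * p * k / m * (k / m) := by gcongr
      _ = n * p * k ^ 2 / m ^ 2 := by field_simp
  have hexpand : ∑ UW ∈ pairSets m n p, (NUWK m G K UW.1 UW.2 - D * q) ^ 2 =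
      ∑ UW ∈ pairSets m n p, NUWK m G K UW.1 UW.2 ^ 2 - T * (D * q) ^ 2 := by
    simp only [sub_sq, Finset.sum_add_distrib, Finset.sum_sub_distrib, ← Finset.sum_mul,
      ← Finset.mul_sum, Finset.sum_const, nsmul_eq_mul, hfirst]
    ring
  rw [hexpand]
  calc _ ≤ D * (T * (D * q ^ 2 + q * (1 + k * (p / m) + k * (n / m)))) - T * (D * q) ^ 2 := by
        gcongr
    _ = T * ((D * q) * (p * k / m + n * k / m + 1)) := by ring
    _ ≤ _ := by gcongr

/-- Chebyshev's inequality for the uniform distribution on a finite set. -/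
lemma card_filter_lt_mul_sq_le {α : Type*} (s : Finset α) (f : α → ℝ) {a t δ : ℝ}
    (hδ : 0 ≤ δ) (h : t + δ ≤ a) :
    ((s.filter fun x => f x < t).card : ℝ) * δ ^ 2 ≤ ∑ x ∈ s, (f x - a) ^ 2 := by
  rw [← nsmul_eq_mul]
  calc _ ≤ ∑ x ∈ s.filter fun x => f x < t, (f x - a) ^ 2 := by
        refine Finset.card_nsmul_le_sum _ _ _ fun x hx => ?_
        have := (Finset.mem_filter.1 hx).2
        nlinarith
    _ ≤ _ := Finset.sum_le_sum_of_subset_of_nonneg (Finset.filter_subset _ _)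
        fun _ _ _ => sq_nonneg _

lemma NUWK_nonneg (m : ℕ) (G : SimpleGraph (Fin m)) (K U W : Finset (Fin m)) :
    0 ≤ NUWK m G K U W :=
  Finset.sum_nonneg fun _ _ => Finset.sum_nonneg fun _ _ => by split_ifs <;> norm_num

/-- The lower bound on the mean of `NUWK`. -/
lemma le_mean_NUWK {m n p κ : ℕ} {ε : ℝ} (hε : 0 < ε) (hκ : (1 + 2 * ε) / ε ≤ (κ : ℝ))
    {D : ℝ} (hD : (1 / 2 + ε) * (κ * (κ - 1)) ≤ D) (hm : 4 ≤ m) :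
    (1 / 2 + ε / 2) * (n * p * κ ^ 2 / m ^ 2 : ℝ) ≤ D * ((n * p : ℝ) / (m * (m - 1))) := by
  have hm' : (4 : ℝ) ≤ m := by exact_mod_cast hm
  have hm1 : (0 : ℝ) < m - 1 := by linarith
  have hm0 : (0 : ℝ) < m := by linarith
  rw [div_le_iff₀ hε] at hκ
  have hD' : (1 / 2 + ε / 2) * (κ : ℝ) ^ 2 ≤ D := by
    nlinarith [mul_le_mul_of_nonneg_left hκ (Nat.cast_nonneg (α := ℝ) κ)]
  have hD0 : 0 ≤ D := le_trans (by positivity) hD'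
  calc (1 / 2 + ε / 2) * (n * p * κ ^ 2 / m ^ 2 : ℝ)
      = ((1 / 2 + ε / 2) * (κ : ℝ) ^ 2) * ((n * p : ℝ) / (m * m)) := by ring
    _ ≤ D * ((n * p : ℝ) / (m * (m - 1))) := by gcongr; linarith

theorem stmt_9 (m n p κ : ℕ) (ε : ℝ) (hε : 0 < ε) (hε2 : ε ≤ 1 / 2)
    (G : SimpleGraph (Fin m)) (K : Finset (Fin m)) (hK : K.card = κ)
    (hκ : (1 + 2 * ε) / ε ≤ (κ : ℝ))
    (hdense : (1 / 2 + ε) * (κ * (κ - 1) / 2) ≤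
      ((G.edgeFinset.filter fun e => ∀ v ∈ e, v ∈ K).card : ℝ))
    (hn : 2 * n < m) (hp : 2 * p < m) :
    (((pairSets m n p).filter fun UW =>
        NUWK m G K UW.1 UW.2 < (1 / 2 + ε / 4) * (n * p * κ ^ 2 / m ^ 2)).card : ℝ) /
        ((pairSets m n p).card : ℝ) ≤
      (4 / ε) * Real.sqrt (m * (p * κ + n * κ + m) / (n * p * κ ^ 2)) := by
  have hm4 : 4 ≤ m := by
    have h4 : (4 : ℝ) ≤ κ := by
      refine le_trans ?_ hκ
      rw [le_div_iff₀ hε]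
      linarith
    have h4' : 4 ≤ κ := by exact_mod_cast h4
    exact h4'.trans (hK ▸ (Finset.card_le_univ K).trans_eq (Fintype.card_fin m))
  by_cases hnp : n = 0 ∨ p = 0
  · have hs : (n * p * κ ^ 2 / m ^ 2 : ℝ) = 0 := by
      rcases hnp with rfl | rfl <;> simp
    rw [hs, mul_zero, Finset.filter_false_of_mem fun UW _ => not_lt.2 (NUWK_nonneg _ _ _ _ _)]
    simp only [Finset.card_empty, Nat.cast_zero, zero_div]
    positivity
  have hn1 : 1 ≤ n := by omega
  have hp1 : 1 ≤ p := by omega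
  have hκ0 : (0 : ℝ) < κ := lt_of_lt_of_le (by positivity) hκ
  have hm0 : (0 : ℝ) < m := by exact_mod_cast (by omega : 0 < m)
  have hn0 : (0 : ℝ) < n := by exact_mod_cast hn1
  have hp0 : (0 : ℝ) < p := by exact_mod_cast hp1
  have hD : (1 / 2 + ε) * (κ * (κ - 1)) ≤ ((adjPairs G K).card : ℝ) := by
    have h : (2 : ℝ) * ((G.edgeFinset.filter fun e => ∀ v ∈ e, v ∈ K).card : ℝ) ≤
        ((adjPairs G K).card : ℝ) := by
      exact_mod_cast two_mul_card_edges_le G K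
    linarith
  have hmean := le_mean_NUWK (n := n) (p := p) hε hκ hD hm4
  have hvar := sum_NUWK_sub_mean_sq_le G K hm4 hn1 hp1 hn hp
  rw [hK] at hvar
  set s : ℝ := (n * p * κ ^ 2 / m ^ 2 : ℝ) with hs
  have hs0 : 0 < s := by positivity
  have hcheb := (card_filter_lt_mul_sq_le (pairSets m n p)
    (fun UW => NUWK m G K UW.1 UW.2) (t := (1 / 2 + ε / 4) * s) (δ := ε / 4 * s)
    (by positivity) (by linarith)).trans hvar
  set B : ℝ := (((pairSets m n p).filter fun UW =>
    NUWK m G K UW.1 UW.2 < (1 / 2 + ε / 4) * s).card : ℝ) with hB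
  set T : ℝ := ((pairSets m n p).card : ℝ) with hT
  have hB0 : 0 ≤ B := Nat.cast_nonneg _
  have hT0 : 0 ≤ T := Nat.cast_nonneg _
  have hBT : B ≤ T := Nat.cast_le.2 (Finset.card_filter_le _ _)
  have hr0 : 0 ≤ B / T := div_nonneg hB0 hT0
  have hr1 : B / T ≤ 1 := div_le_one_of_le₀ hBT hT0
  set Q : ℝ := m * (p * κ + n * κ + m) / (n * p * κ ^ 2) with hQ
  have hQs : s * (p * κ / m + n * κ / m + 1) = Q * s ^ 2 := by
    rw [hs, hQ]
    field_simp
  have hr : B / T ≤ (4 / ε) ^ 2 * Q := by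
    refine div_le_of_le_mul₀ hT0 (by positivity) ?_
    rw [hQs] at hcheb
    have h2 : 0 < (ε / 4 * s) ^ 2 := by positivity
    refine le_of_mul_le_mul_right (hcheb.trans_eq ?_) h2
    field_simp
  calc B / T = Real.sqrt ((B / T) ^ 2) := (Real.sqrt_sq hr0).symm
    _ ≤ Real.sqrt ((4 / ε) ^ 2 * Q) := Real.sqrt_le_sqrt (by nlinarith)
    _ = 4 / ε * Real.sqrt Q := by
        rw [Real.sqrt_mul (sq_nonneg _), Real.sqrt_sq (by positivity)]
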